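/- Let p ≥ 2 and n = 3p−1, and for i ∈ ℤ let ī denote the unique element of [n] with ī ≡ i (mod n). Let Σ = ⟨{ {ī, (i+1)¯, (i+2)¯} : i=1,…,n }⟩, and for i=1,…,n and j=1,…,p−2 let Δ(i,j) = ⟨{ī, (i+1)¯, (i+2+3j)¯}, {(i+1+3j)¯, (i+2+3j)¯, (i+1)¯}⟩. Set Δ̂ = Σ ∪ (⋃_{i,j} Δ(i,j)) and M = (1/3)·C(n−2,2). Then Δ̂ is Buchsbaum, link-acyclic, and h(Δ̂) = (1, n−3, 3M, −M). -/

import Mathlib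

open Finset

noncomputable section

/-- `Δ` is a simplicial complex on `[n] = {1,…,n}`: a collection of subsets of `[n]`,
closed under taking subsets, containing every singleton `{i}` for `i ∈ [n]`. -/
def IsComplexOn (n : ℕ) (Δ : Finset (Finset ℕ)) : Prop :=
  (∀ F ∈ Δ, ∀ G ⊆ F, G ∈ Δ) ∧
  (∀ F ∈ Δ, ∀ i ∈ F, i ∈ Finset.Icc 1 n) ∧
  (∀ i ∈ Finset.Icc 1 n, ({i} : Finset ℕ) ∈ Δ)

/-- a simplicial complex whose vertex set is contained in `[n]`:
a downward closed collection of subsets of `[n]`. -/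
def IsComplexIn (n : ℕ) (Δ : Finset (Finset ℕ)) : Prop :=
  (∀ F ∈ Δ, ∀ G ⊆ F, G ∈ Δ) ∧ (∀ F ∈ Δ, ∀ i ∈ F, i ∈ Finset.Icc 1 n)

/-- the faces of `Δ` with `m` vertices -/
def facesOf (Δ : Finset (Finset ℕ)) (m : ℕ) : Finset (Finset ℕ) :=
  Δ.filter fun F => F.card = m

/-- `fVec Δ j = f_{j-1}(Δ)`, the number of faces of `Δ` with `j` vertices;
by convention `f_{-1}(Δ) = 1`. -/
def fVec (Δ : Finset (Finset ℕ)) (j : ℕ) : ℤ :=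
  if j = 0 then 1 else ((facesOf Δ j).card : ℤ)

/-- the `h`-vector of a `(d-1)`-dimensional complex, defined by
`∑ f_{i-1} (x-1)^{d-i} = ∑ h_i x^{d-i}`, i.e.
`h_i = ∑_{j=0}^{i} (-1)^{i-j} C(d-j, i-j) f_{j-1}`. -/
def hVec (d : ℕ) (Δ : Finset (Finset ℕ)) (i : ℕ) : ℤ :=
  ∑ j ∈ Finset.range (i + 1),
    (-1 : ℤ) ^ (i - j) * ((d - j).choose (i - j) : ℤ) * fVec Δ j

/-- the dimension `max {k : f_k(Δ) ≠ 0}` of `Δ`, as an integer -/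
def dimZ (Δ : Finset (Finset ℕ)) : ℤ := ((Δ.sup Finset.card : ℕ) : ℤ) - 1

/-- the link `lk_Δ(F) = {G : G ∩ F = ∅, G ∪ F ∈ Δ}` -/
def link (Δ : Finset (Finset ℕ)) (F : Finset ℕ) : Finset (Finset ℕ) :=
  Δ.filter fun G => Disjoint G F ∧ G ∪ F ∈ Δ

variable (K : Type) [Field K]

/-- the simplicial boundary operator on formal `K`-linear combinations of
finite subsets of `ℕ` (vertices ordered by the order on `ℕ`):
`∂ F = ∑_{v ∈ F} (-1)^{#{u ∈ F : u < v}} (F \ {v})`. -/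
def bdry : (Finset ℕ →₀ K) →ₗ[K] (Finset ℕ →₀ K) :=
  Finsupp.lsum K fun F => LinearMap.toSpanSingleton K (Finset ℕ →₀ K)
    (∑ v ∈ F, ((-1 : K) ^ ((F.filter fun u => u < v).card)) • Finsupp.single (F.erase v) (1 : K))

/-- the space of simplicial `K`-chains of `Δ` spanned by the faces with `m` vertices
(for `m = 0` this is the span of the empty face, giving *reduced* homology) -/
def chains (Δ : Finset (Finset ℕ)) (m : ℕ) : Submodule K (Finset ℕ →₀ K) :=
  Submodule.span K ((fun F => Finsupp.single F (1 : K)) '' (facesOf Δ m : Set (Finset ℕ)))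

/-- the dimension of the reduced homology of `Δ` at faces of cardinality `m`:
`dim (ker ∂ ∩ C_m) - dim (∂ C_{m+1})` -/
def homDim (Δ : Finset (Finset ℕ)) (m : ℕ) : ℕ :=
  Module.finrank K ↥(chains K Δ m ⊓ LinearMap.ker (bdry K))
    - Module.finrank K ↥((chains K Δ (m + 1)).map (bdry K))

/-- the reduced Betti number `β_i(Δ; K) = dim_K H̃_i(Δ; K)` for `i : ℤ` -/
def betti (Δ : Finset (Finset ℕ)) (i : ℤ) : ℕ :=
  if 0 ≤ i + 1 then homDim K Δ (i + 1).toNat else 0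

/-- all facets (maximal faces) of `Δ` have the same cardinality -/
def IsPure (Δ : Finset (Finset ℕ)) : Prop :=
  ∀ F ∈ Δ, (∀ G ∈ Δ, F ⊆ G → F = G) → F.card = Δ.sup Finset.card

/-- `Δ` is Cohen–Macaulay (over `K`): for every face `F ∈ Δ` (including `∅`),
`β_i(lk_Δ(F)) = 0` for all `i ≠ dim Δ - |F|`. -/
def IsCohenMacaulay (Δ : Finset (Finset ℕ)) : Prop :=
  ∀ F ∈ Δ, ∀ i : ℤ, i ≠ dimZ Δ - F.card → betti K (link Δ F) i = 0

/-- `Δ` is Buchsbaum (over `K`): `Δ` is pure and the link of every vertex is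
Cohen–Macaulay. -/
def IsBuchsbaum (Δ : Finset (Finset ℕ)) : Prop :=
  IsPure Δ ∧ ∀ v : ℕ, ({v} : Finset ℕ) ∈ Δ → IsCohenMacaulay K (link Δ {v})

/-- `Δ` is connected: any two vertices are joined by a path of edges of `Δ` -/
def IsConnectedComplex (Δ : Finset (Finset ℕ)) : Prop :=
  ∀ u v : ℕ, ({u} : Finset ℕ) ∈ Δ → ({v} : Finset ℕ) ∈ Δ →
    Relation.ReflTransGen (fun a b : ℕ => a ≠ b ∧ ({a, b} : Finset ℕ) ∈ Δ) u v

/-- `Δ` is link-acyclic: `β_i(lk_Δ(v)) = 0` for every vertex `v` of `Δ` and every `i` -/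
def IsLinkAcyclic (Δ : Finset (Finset ℕ)) : Prop :=
  ∀ v : ℕ, ({v} : Finset ℕ) ∈ Δ → ∀ i : ℤ, betti K (link Δ {v}) i = 0

/-- `Δ` is `2`-dimensional with `h`-vector `(a, b, c, e)` -/
def hVector3 (Δ : Finset (Finset ℕ)) (a b c e : ℤ) : Prop :=
  hVec 3 Δ 0 = a ∧ hVec 3 Δ 1 = b ∧ hVec 3 Δ 2 = c ∧ hVec 3 Δ 3 = e

/-- `macaulay2 a = a^⟨2⟩`: if `a = C(b,2) + r` is the (greedy) `2`-nd Macaulay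
representation (`b` maximal with `C(b,2) ≤ a`, `0 ≤ r < b`, `r = C(r,1)`), then
`a^⟨2⟩ = C(b+1,3) + C(r+1,2)`, and `0^⟨2⟩ = 0`. -/
def macaulay2 (a : ℕ) : ℕ :=
  if a = 0 then 0
  else
    (Nat.findGreatest (fun t => t.choose 2 ≤ a) (a + 2) + 1).choose 3
      + (a - (Nat.findGreatest (fun t => t.choose 2 ≤ a) (a + 2)).choose 2 + 1).choose 2

/-- `modRep n i = ī`, the unique element of `[n] = {1,…,n}` congruent to `i` mod `n` -/
def modRep (n : ℕ) (i : ℤ) : ℕ := ((i - 1) % (n : ℤ)).toNat + 1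


/-- `Σ` for `n = 3p-1`: generated by `{ī, (i+1)¯, (i+2)¯}`, `i = 1,…,n` -/
def SigmaA (p : ℕ) : Finset (Finset ℕ) :=
  (Finset.Icc 1 (3 * p - 1)).biUnion fun i =>
    ({modRep (3 * p - 1) (i : ℤ), modRep (3 * p - 1) ((i : ℤ) + 1),
      modRep (3 * p - 1) ((i : ℤ) + 2)} : Finset ℕ).powerset

/-- `Δ(i,j)` for `n = 3p-1`: generated by `{ī, (i+1)¯, (i+2+3j)¯}` and
`{(i+1+3j)¯, (i+2+3j)¯, (i+1)¯}` -/
def DeltaA (p i j : ℕ) : Finset (Finset ℕ) :=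
  ({modRep (3 * p - 1) (i : ℤ), modRep (3 * p - 1) ((i : ℤ) + 1),
    modRep (3 * p - 1) ((i : ℤ) + 2 + 3 * (j : ℤ))} : Finset ℕ).powerset ∪
  ({modRep (3 * p - 1) ((i : ℤ) + 1 + 3 * (j : ℤ)),
    modRep (3 * p - 1) ((i : ℤ) + 2 + 3 * (j : ℤ)),
    modRep (3 * p - 1) ((i : ℤ) + 1)} : Finset ℕ).powerset

/-- `Δ̂ = Σ ∪ ⋃_{i,j} Δ(i,j)` for `n = 3p-1` -/
def hatDeltaA (p : ℕ) : Finset (Finset ℕ) :=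
  SigmaA p ∪ ((Finset.Icc 1 (3 * p - 1)) ×ˢ (Finset.Icc 1 (p - 2))).biUnion
    fun q => DeltaA p q.1 q.2

end

section Homology

variable {K : Type} [Field K] {Δ : Finset (Finset ℕ)} {m : ℕ}

lemma chains_eq_supported (Δ : Finset (Finset ℕ)) (m : ℕ) :
    chains K Δ m = Finsupp.supported K K (facesOf Δ m : Set (Finset ℕ)) :=
  (Finsupp.supported_eq_span_single K _).symm

instance finiteDimensional_chains (Δ : Finset (Finset ℕ)) (m : ℕ) :
    FiniteDimensional K (chains K Δ m) :=
  FiniteDimensional.span_of_finite K ((facesOf Δ m).finite_toSet.image _)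

lemma finrank_chains (Δ : Finset (Finset ℕ)) (m : ℕ) :
    Module.finrank K (chains K Δ m) = (facesOf Δ m).card := by
  rw [chains_eq_supported, (Finsupp.supportedEquivFinsupp _).finrank_eq,
    Module.finrank_finsupp_self]
  simp

lemma chains_eq_bot (h : facesOf Δ m = ∅) : chains K Δ m = ⊥ := by
  simp [chains, h]

lemma finrank_map_add_finrank_inf_ker {V W : Type*} [AddCommGroup V] [Module K V]
    [AddCommGroup W] [Module K W] (f : V →ₗ[K] W) (S : Submodule K V) [FiniteDimensional K S] :
    Module.finrank K (S.map f) + Module.finrank K ↥(S ⊓ LinearMap.ker f) =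
      Module.finrank K S := by
  have h := (f.domRestrict S).finrank_range_add_finrank_ker
  rwa [LinearMap.range_domRestrict, LinearMap.ker_domRestrict,
    ← Submodule.finrank_map_subtype_eq, Submodule.map_comap_subtype] at h

lemma single_mem_chains {F : Finset ℕ} (hF : F ∈ Δ) (hm : F.card = m) :
    Finsupp.single F (1 : K) ∈ chains K Δ m :=
  Submodule.subset_span ⟨F, by simp [facesOf, hF, hm], rfl⟩

lemma homDim_eq_zero_of_le
    (h : chains K Δ m ⊓ LinearMap.ker (bdry K) ≤ (chains K Δ (m + 1)).map (bdry K)) :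
    homDim K Δ m = 0 :=
  Nat.sub_eq_zero_of_le (Submodule.finrank_mono h)

lemma homDim_eq_zero_of_facesOf_eq_empty (h : facesOf Δ m = ∅) : homDim K Δ m = 0 :=
  homDim_eq_zero_of_le (inf_le_left.trans ((chains_eq_bot h).le.trans bot_le))

lemma bdry_single (F : Finset ℕ) :
    bdry K (Finsupp.single F 1) = ∑ v ∈ F, ((-1 : K) ^ ((F.filter fun u => u < v).card)) •
      Finsupp.single (F.erase v) (1 : K) := by
  simp [bdry]

lemma bdry_single_vertex (v : ℕ) :
    bdry K (Finsupp.single {v} 1) = Finsupp.single ∅ 1 := by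
  rw [bdry_single]
  simp [Finset.filter_singleton]

lemma bdry_single_edge_of_lt {a b : ℕ} (h : a < b) :
    bdry K (Finsupp.single {a, b} 1) = Finsupp.single {b} 1 - Finsupp.single {a} 1 := by
  have hab : a ≠ b := h.ne
  have e1 : ({a, b} : Finset ℕ).erase a = {b} := by
    ext x; simp; omega
  have e2 : ({a, b} : Finset ℕ).erase b = {a} := by
    ext x; simp; omega
  have f1 : ({a, b} : Finset ℕ).filter (fun u => u < a) = ∅ := by
    ext x; simp; omega
  have f2 : ({a, b} : Finset ℕ).filter (fun u => u < b) = {a} := by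
    ext x; simp; omega
  rw [bdry_single, Finset.sum_pair hab, e1, e2, f1, f2]
  simp [sub_eq_add_neg]

lemma homDim_zero_eq_zero {v : ℕ} (hv : {v} ∈ Δ) : homDim K Δ 0 = 0 := by
  refine homDim_eq_zero_of_le (inf_le_left.trans ?_)
  rw [chains, Submodule.span_le]
  rintro _ ⟨F, hF, rfl⟩
  have hF0 : F = ∅ := by simpa [facesOf] using (Finset.mem_filter.1 (Finset.mem_coe.1 hF)).2
  subst hF0
  exact ⟨Finsupp.single {v} 1, single_mem_chains hv (by simp), bdry_single_vertex v⟩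

lemma vertex_sub_vertex_mem_boundaries {a b : ℕ} (hab : a ≠ b) (h : {a, b} ∈ Δ) :
    Finsupp.single {b} (1 : K) - Finsupp.single {a} 1 ∈ (chains K Δ 2).map (bdry K) := by
  rcases lt_or_gt_of_ne hab with hlt | hlt
  · exact ⟨_, single_mem_chains h (Finset.card_pair hab), bdry_single_edge_of_lt hlt⟩
  · rw [Finset.pair_comm] at h
    rw [← neg_sub]
    exact neg_mem ⟨_, single_mem_chains h (Finset.card_pair hab.symm), bdry_single_edge_of_lt hlt⟩

lemma boundaries_le_ker :
    (chains K Δ 2).map (bdry K) ≤ LinearMap.ker (bdry K) := by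
  rw [Submodule.map_le_iff_le_comap, chains, Submodule.span_le]
  rintro _ ⟨F, hF, rfl⟩
  obtain ⟨a, b, hab, rfl⟩ := Finset.card_eq_two.1 (Finset.mem_filter.1 (Finset.mem_coe.1 hF)).2
  rcases lt_or_gt_of_ne hab with hlt | hlt
  · simp [bdry_single_edge_of_lt hlt, bdry_single_vertex]
  · rw [Finset.pair_comm]
    simp [bdry_single_edge_of_lt hlt, bdry_single_vertex]

/-- A connected graph with fewer edges than vertices has vanishing reduced homology. -/
lemma homDim_eq_zero_of_tree {r : ℕ} (hr : {r} ∈ Δ) (hcard : ∀ F ∈ Δ, F.card ≤ 2)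
    (hconn : ∀ v, {v} ∈ Δ →
      Finsupp.single {v} (1 : K) - Finsupp.single {r} 1 ∈ (chains K Δ 2).map (bdry K))
    (hlt : (facesOf Δ 2).card < (facesOf Δ 1).card) (m : ℕ) : homDim K Δ m = 0 := by
  have hle : chains K Δ 1 ≤
      (chains K Δ 2).map (bdry K) ⊔ Submodule.span K {Finsupp.single {r} (1 : K)} := by
    rw [chains, Submodule.span_le]
    rintro _ ⟨F, hF, rfl⟩
    obtain ⟨hF, hF1⟩ := Finset.mem_filter.1 (Finset.mem_coe.1 hF)
    obtain ⟨v, rfl⟩ := Finset.card_eq_one.1 hF1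
    exact Submodule.mem_sup.2 ⟨_, hconn v hF, _, Submodule.mem_span_singleton_self _, by simp⟩
  match m with
  | 0 => exact homDim_zero_eq_zero hr
  | 1 =>
    refine homDim_eq_zero_of_le ?_
    rintro c ⟨hc, hker⟩
    obtain ⟨b, hb, s, hs, rfl⟩ := Submodule.mem_sup.1 (hle hc)
    obtain ⟨a, rfl⟩ := Submodule.mem_span_singleton.1 hs
    have hb0 : bdry K b = 0 := boundaries_le_ker hb
    have hker : bdry K (b + a • Finsupp.single {r} 1) = 0 := hker
    rw [map_add, map_smul, hb0, bdry_single_vertex] at hker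
    have ha : a = 0 := by simpa using hker
    simpa [ha] using hb
  | 2 =>
    have h1 := (Submodule.finrank_mono hle).trans (Submodule.finrank_add_le_finrank_add_finrank _ _)
    have h2 := finrank_span_le_card (R := K) ({Finsupp.single {r} (1 : K)} : Set (Finset ℕ →₀ K))
    have h3 := finrank_map_add_finrank_inf_ker (bdry K) (chains K Δ 2)
    rw [finrank_chains] at h1 h3
    simp only [Set.toFinset_singleton, Finset.card_singleton] at h2
    refine Nat.sub_eq_zero_of_le ?_
    omega
  | m + 3 =>
    refine homDim_eq_zero_of_facesOf_eq_empty (Finset.filter_eq_empty_iff.2 fun F hF => ?_)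
    have := hcard F hF
    omega

lemma betti_eq_zero_of_homDim {i : ℤ} (h : 0 ≤ i + 1 → homDim K Δ (i + 1).toNat = 0) :
    betti K Δ i = 0 := by
  unfold betti
  split_ifs with hi
  · exact h hi
  · rfl

lemma mem_link {F G : Finset ℕ} (hΔ : ∀ F ∈ Δ, ∀ G ⊆ F, G ∈ Δ) :
    G ∈ link Δ F ↔ Disjoint G F ∧ G ∪ F ∈ Δ := by
  simp only [link, Finset.mem_filter, and_iff_right_iff_imp]
  exact fun h => hΔ _ h.2 _ Finset.subset_union_left

lemma facesOf_link_eq_empty {F : Finset ℕ} {d : ℕ} (hcard : ∀ F ∈ Δ, F.card ≤ d)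
    (h : d < m + F.card) : facesOf (link Δ F) m = ∅ := by
  refine Finset.filter_eq_empty_iff.2 fun G hG hGm => ?_
  obtain ⟨-, hdisj, hmem⟩ := Finset.mem_filter.1 hG
  have := hcard _ hmem
  rw [Finset.card_union_of_disjoint hdisj] at this
  omega

/-- An acyclic graph without isolated vertices is Cohen–Macaulay. -/
lemma isCohenMacaulay_of_acyclic_graph (hΔ : ∀ F ∈ Δ, ∀ G ⊆ F, G ∈ Δ)
    (hcard : ∀ F ∈ Δ, F.card ≤ 2) {r : ℕ} (hr : {r} ∈ Δ)
    (hedge : ∀ u, {u} ∈ Δ → ∃ w, w ≠ u ∧ {w, u} ∈ Δ)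
    (hacyc : ∀ m, homDim K Δ m = 0) : IsCohenMacaulay K Δ := by
  have hdim : dimZ Δ = 1 := by
    have : Δ.sup Finset.card = 2 := by
      refine le_antisymm (Finset.sup_le hcard) ?_
      obtain ⟨w, hw, hmem⟩ := hedge r hr
      exact (Finset.card_pair hw).symm.le.trans (Finset.le_sup (f := Finset.card) hmem)
    simp [dimZ, this]
  intro F hF i hi
  rw [hdim] at hi
  have hF2 := hcard F hF
  refine betti_eq_zero_of_homDim fun hi0 => ?_
  rcases Nat.eq_zero_or_pos F.card with h0 | hpos
  · obtain rfl := Finset.card_eq_zero.1 h0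
    have : link Δ ∅ = Δ := by
      ext G; simp [link]
    rw [this]
    exact hacyc _
  by_cases h : 2 < (i + 1).toNat + F.card
  · exact homDim_eq_zero_of_facesOf_eq_empty (facesOf_link_eq_empty hcard h)
  · have hF1 : F.card = 1 := by omega
    have hi1 : (i + 1).toNat = 0 := by omega
    obtain ⟨u, rfl⟩ := Finset.card_eq_one.1 hF1
    obtain ⟨w, hw, hmem⟩ := hedge u hF
    rw [hi1]
    refine homDim_zero_eq_zero (v := w) ((mem_link hΔ).2 ⟨by simpa using hw, ?_⟩)
    rwa [← Finset.insert_eq]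

end Homology

section ModRep

variable {n : ℕ}

lemma modRep_eq_iff (hn : 0 < n) {a b : ℤ} : modRep n a = modRep n b ↔ (n : ℤ) ∣ a - b := by
  have h1 := Int.emod_nonneg (a - 1) (b := n) (by omega)
  have h2 := Int.emod_nonneg (b - 1) (b := n) (by omega)
  have h3 : a - b = (a - 1) - (b - 1) := by ring
  rw [h3, Int.dvd_iff_emod_eq_zero, ← Int.emod_eq_emod_iff_emod_sub_eq_zero]
  unfold modRep
  omega

lemma modRep_mem (hn : 0 < n) (a : ℤ) : modRep n a ∈ Finset.Icc 1 n := by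
  have h1 := Int.emod_nonneg (a - 1) (b := n) (by omega)
  have h2 := Int.emod_lt_of_pos (a - 1) (b := n) (by omega)
  rw [Finset.mem_Icc]
  unfold modRep
  omega

lemma modRep_of_mem {v : ℕ} (hv : v ∈ Finset.Icc 1 n) : modRep n v = v := by
  rw [Finset.mem_Icc] at hv
  unfold modRep
  rw [Int.emod_eq_of_lt] <;> omega

lemma modRep_congr (hn : 0 < n) {a b : ℤ} (h : modRep n a = modRep n b) (k : ℤ) :
    modRep n (a + k) = modRep n (b + k) := by
  rw [modRep_eq_iff hn] at h ⊢
  simpa using h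

lemma modRep_add_self (hn : 0 < n) (a : ℤ) : modRep n (a + n) = modRep n a := by
  rw [modRep_eq_iff hn]
  simp

lemma eq_or_of_modRep_eq (hn : 0 < n) {a b : ℤ} (h : modRep n a = modRep n b)
    (h1 : a - b < 2 * n) (h2 : b - a < 2 * n) : a = b ∨ a = b + n ∨ b = a + n := by
  obtain ⟨k, hk⟩ := (modRep_eq_iff hn).1 h
  have hk1 : k < 2 := by nlinarith
  have hk2 : -2 < k := by nlinarith
  obtain rfl | rfl | rfl : k = -1 ∨ k = 0 ∨ k = 1 := by omega
  all_goals omega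

end ModRep

/-- The facet `{ī, (i+1)¯, (i+2+3j)¯}`; the facets with `j = 0` generate `Σ`. -/
def tri (n : ℕ) (i : ℤ) (j : ℕ) : Finset ℕ :=
  {modRep n i, modRep n (i + 1), modRep n (i + 2 + 3 * j)}

/-- The parent function of the link of a vertex `v`, a tree rooted at `v + 1`;
vertices are encoded by their offset from `v`. -/
def par (n x : ℕ) : ℕ :=
  if x % 3 = 2 then 1 else if x % 3 = 0 then x + 1 else if x + 1 = n then 1 else n - 1

section Facets

variable {p n : ℕ}

lemma mem_hatDeltaA (hp : 2 ≤ p) (hn : n + 1 = 3 * p) (F : Finset ℕ) :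
    F ∈ hatDeltaA p ↔ ∃ i ∈ Finset.Icc 1 n, ∃ j < p - 1, F ⊆ tri n (i : ℕ) j := by
  obtain rfl : n = 3 * p - 1 := by omega
  have hn0 : 0 < 3 * p - 1 := by omega
  simp only [hatDeltaA, SigmaA, DeltaA, Finset.mem_union, Finset.mem_biUnion, Finset.mem_powerset,
    Finset.mem_product, Prod.exists]
  constructor
  · rintro (⟨i, hi, hF⟩ | ⟨i, j, ⟨hi, hj⟩, hF | hF⟩)
    · exact ⟨i, hi, 0, by omega, by simpa [tri] using hF⟩
    · rw [Finset.mem_Icc] at hj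
      exact ⟨i, hi, j, by omega, hF⟩
    · rw [Finset.mem_Icc] at hj
      refine ⟨modRep (3 * p - 1) (i + 1 + 3 * j), modRep_mem hn0 _, p - 1 - j, by omega, ?_⟩
      have h := modRep_congr hn0 (modRep_of_mem (modRep_mem hn0 ((i : ℤ) + 1 + 3 * j)))
      have h0 := modRep_of_mem (modRep_mem hn0 ((i : ℤ) + 1 + 3 * j))
      rw [tri, add_assoc _ 2, h, h, h0]
      have e : (i : ℤ) + 1 + 3 * j + (2 + 3 * (p - 1 - j : ℕ)) = i + 1 + (3 * p - 1 : ℕ) := by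
        omega
      rw [e, modRep_add_self hn0]
      convert hF using 4
      ring
  · rintro ⟨i, hi, j, hj, hF⟩
    rcases Nat.eq_zero_or_pos j with rfl | hj0
    · exact Or.inl ⟨i, hi, by simpa [tri] using hF⟩
    · exact Or.inr ⟨i, j, ⟨hi, Finset.mem_Icc.2 ⟨hj0, by omega⟩⟩, Or.inl hF⟩

lemma mem_hatDeltaA_of_subset_tri (hp : 2 ≤ p) (hn : n + 1 = 3 * p) {F : Finset ℕ} {i : ℤ} {j : ℕ}
    (hj : j < p - 1) (hF : F ⊆ tri n i j) : F ∈ hatDeltaA p := by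
  have hn0 : 0 < n := by omega
  rw [mem_hatDeltaA hp hn]
  refine ⟨modRep n i, modRep_mem hn0 _, j, hj, ?_⟩
  have h0 := modRep_of_mem (modRep_mem hn0 i)
  have h := modRep_congr hn0 h0
  rw [tri, add_assoc _ 2, h, h, h0, ← add_assoc]
  exact hF

lemma hatDeltaA_downward (hp : 2 ≤ p) (hn : n + 1 = 3 * p) :
    ∀ F ∈ hatDeltaA p, ∀ G ⊆ F, G ∈ hatDeltaA p := by
  intro F hF G hG
  rw [mem_hatDeltaA hp hn] at hF ⊢
  obtain ⟨i, hi, j, hj, h⟩ := hF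
  exact ⟨i, hi, j, hj, hG.trans h⟩

lemma modRep_ne (hn0 : 0 < n) {a b : ℤ} (h1 : a < b) (h2 : b < a + n) :
    modRep n a ≠ modRep n b := by
  intro h
  have := eq_or_of_modRep_eq hn0 h (by omega) (by omega)
  omega

lemma card_tri (hn : n + 1 = 3 * p) (i : ℤ) {j : ℕ} (hj : j < p - 1) : (tri n i j).card = 3 := by
  have hn0 : 0 < n := by omega
  refine Finset.card_eq_three.2 ⟨_, _, _, ?_, ?_, ?_, rfl⟩ <;>
    exact modRep_ne hn0 (by omega) (by omega)

lemma tri_subset_Icc (hn0 : 0 < n) (i : ℤ) (j : ℕ) : tri n i j ⊆ Finset.Icc 1 n := by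
  intro x hx
  simp only [tri, Finset.mem_insert, Finset.mem_singleton] at hx
  rcases hx with rfl | rfl | rfl <;> exact modRep_mem hn0 _

lemma subset_Icc_of_mem_hatDeltaA (hp : 2 ≤ p) (hn : n + 1 = 3 * p) {F : Finset ℕ}
    (hF : F ∈ hatDeltaA p) : F ⊆ Finset.Icc 1 n := by
  obtain ⟨i, -, j, -, h⟩ := (mem_hatDeltaA hp hn F).1 hF
  exact h.trans (tri_subset_Icc (by omega) _ _)

lemma card_le_three_of_mem_hatDeltaA (hp : 2 ≤ p) (hn : n + 1 = 3 * p) {F : Finset ℕ}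
    (hF : F ∈ hatDeltaA p) : F.card ≤ 3 := by
  obtain ⟨i, -, j, hj, h⟩ := (mem_hatDeltaA hp hn F).1 hF
  exact (Finset.card_le_card h).trans (card_tri hn _ hj).le

lemma tri_injOn (hn : n + 1 = 3 * p) {i i' j j' : ℕ} (hi : i ∈ Finset.Icc 1 n)
    (hi' : i' ∈ Finset.Icc 1 n) (hj : j < p - 1) (hj' : j' < p - 1)
    (h : tri n i j = tri n i' j') : i = i' ∧ j = j' := by
  have hn0 : 0 < n := by omega
  rw [Finset.mem_Icc] at hi hi'
  have key : ∀ k : ℤ, 0 ≤ k → k ≤ 2 + 3 * j → modRep n (i + k) ∈ tri n i j →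
      (i : ℤ) + k = i' ∨ (i : ℤ) + k = i' + n ∨ i' = i + k + n ∨
      (i : ℤ) + k = i' + 1 ∨ (i : ℤ) + k = i' + 1 + n ∨ i' + 1 = i + k + n ∨
      (i : ℤ) + k = i' + 2 + 3 * j' ∨ (i : ℤ) + k = i' + 2 + 3 * j' + n ∨
        i' + 2 + 3 * j' = i + k + n := by
    intro k hk0 hk hmem
    rw [h] at hmem
    simp only [tri, Finset.mem_insert, Finset.mem_singleton] at hmem
    rcases hmem with hmem | hmem | hmem <;>
    · have := eq_or_of_modRep_eq hn0 hmem (by omega) (by omega)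
      omega
  have k0 := key 0 le_rfl (by omega) (by simp [tri])
  have k1 := key 1 (by omega) (by omega) (by simp [tri])
  have k2 := key (2 + 3 * j) (by omega) (by omega) (by simp [tri, add_assoc])
  have hii : i = i' := by omega
  subst hii
  refine ⟨rfl, ?_⟩
  omega

lemma par_mem (hn : n + 1 = 3 * p) {x : ℕ} (hx : x ∈ Finset.Icc 2 (n - 1)) :
    par n x ∈ Finset.Icc 1 (n - 1) := by
  rw [Finset.mem_Icc] at *
  unfold par
  split_ifs <;> omega

lemma par_ne (hn : n + 1 = 3 * p) {x : ℕ} (hx : x ∈ Finset.Icc 2 (n - 1)) : par n x ≠ x := by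
  rw [Finset.mem_Icc] at *
  unfold par
  split_ifs <;> omega

/-- Every property holding at the root and inherited from the parent holds on the whole tree. -/
lemma par_induction (hp : 2 ≤ p) (hn : n + 1 = 3 * p) {P : ℕ → Prop} (h1 : P 1)
    (hstep : ∀ x ∈ Finset.Icc 2 (n - 1), P (par n x) → P x) :
    ∀ x ∈ Finset.Icc 1 (n - 1), P x := by
  have step : ∀ x y, 2 ≤ x → x < n → par n x = y → P y → P x := fun x y hx hx' hxy hy =>
    hstep x (Finset.mem_Icc.2 ⟨hx, by omega⟩) (hxy ▸ hy)
  intro x hx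
  rw [Finset.mem_Icc] at hx
  have hlast : P (n - 1) :=
    step (n - 1) 1 (by omega) (by omega) (by unfold par; split_ifs <;> omega) h1
  have hone : ∀ y, 1 ≤ y → y < n → y % 3 = 1 → P y := by
    intro y hy hyn hmod
    by_cases hy1 : y = 1
    · exact hy1 ▸ h1
    by_cases hyl : y = n - 1
    · exact hyl ▸ hlast
    exact step y (n - 1) (by omega) hyn (by unfold par; split_ifs <;> omega) hlast
  rcases (by omega : x % 3 = 0 ∨ x % 3 = 1 ∨ x % 3 = 2) with h | h | h
  · exact step x (x + 1) (by omega) (by omega) (by unfold par; split_ifs <;> omega)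
      (hone _ (by omega) (by omega) (by omega))
  · exact hone x hx.1 (by omega) h
  · exact step x 1 (by omega) (by omega) (by unfold par; split_ifs; omega) h1

lemma offset_injOn (hn0 : 0 < n) (v : ℕ) {x y : ℕ} (hx : x ∈ Finset.Icc 1 (n - 1))
    (hy : y ∈ Finset.Icc 1 (n - 1)) (h : modRep n (v + x) = modRep n (v + y)) : x = y := by
  rw [Finset.mem_Icc] at hx hy
  have := eq_or_of_modRep_eq hn0 h (by omega) (by omega)
  omega

lemma offset_ne {v x : ℕ} (hv : v ∈ Finset.Icc 1 n) (hx : x ∈ Finset.Icc 1 (n - 1)) :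
    modRep n (v + x) ≠ v := by
  rw [Finset.mem_Icc] at hx
  have := (modRep_ne (n := n) (a := v) (b := v + x) (by omega) (by omega) (by omega)).symm
  rwa [modRep_of_mem hv] at this

lemma exists_offset {v w : ℕ} (hv : v ∈ Finset.Icc 1 n) (hw : w ∈ Finset.Icc 1 n) (h : w ≠ v) :
    ∃ x ∈ Finset.Icc 1 (n - 1), modRep n (v + x) = w := by
  have hw' := hw
  rw [Finset.mem_Icc] at hv hw
  have hn0 : 0 < n := by omega
  rcases lt_or_gt_of_ne h with hlt | hlt
  · refine ⟨w + n - v, by rw [Finset.mem_Icc]; omega, ?_⟩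
    rw [show (v : ℤ) + (w + n - v : ℕ) = w + n by omega, modRep_add_self hn0, modRep_of_mem hw']
  · refine ⟨w - v, by rw [Finset.mem_Icc]; omega, ?_⟩
    rw [show (v : ℤ) + (w - v : ℕ) = w by omega, modRep_of_mem hw']

lemma mem_link_hatDeltaA (hp : 2 ≤ p) (hn : n + 1 = 3 * p) {v : ℕ} (hv : v ∈ Finset.Icc 1 n)
    (G : Finset ℕ) : G ∈ link (hatDeltaA p) {v} ↔
      ∃ x ∈ Finset.Icc 2 (n - 1), G ⊆ {modRep n (v + x), modRep n (v + par n x)} := by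
  have hn0 : 0 < n := by omega
  have hv0 := modRep_of_mem hv
  rw [mem_link (hatDeltaA_downward hp hn), Finset.disjoint_singleton_right]
  constructor
  · rintro ⟨hvG, hmem⟩
    obtain ⟨i, -, j, hj, hF⟩ := (mem_hatDeltaA hp hn _).1 hmem
    have hvi : v ∈ tri n i j := hF (by simp)
    have hG : ∀ g ∈ G, g ≠ v ∧
        (g = modRep n i ∨ g = modRep n (i + 1) ∨ g = modRep n (i + 2 + 3 * j)) := by
      intro g hg
      refine ⟨fun h => hvG (h ▸ hg), ?_⟩
      simpa [tri] using hF (Finset.mem_union_left _ hg)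
    simp only [tri, Finset.mem_insert, Finset.mem_singleton] at hvi
    rcases hvi with hvi | hvi | hvi
    · have hc := modRep_congr hn0 (hv0.trans hvi)
      refine ⟨2 + 3 * j, by rw [Finset.mem_Icc]; omega, fun g hg => ?_⟩
      have hpar : par n (2 + 3 * j) = 1 := by unfold par; split_ifs <;> omega
      rw [hpar, hc, hc, Finset.mem_insert, Finset.mem_singleton]
      obtain ⟨hgv, h | h | h⟩ := hG g hg
      · exact absurd (h.trans hvi.symm) hgv
      · right; simpa using h
      · left; rw [h]; congr 1; push_cast; ring
    · have hc := modRep_congr hn0 (hv0.trans hvi)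
      have hlast : modRep n (v + (n - 1 : ℕ)) = modRep n i := by
        rw [hc, ← modRep_add_self hn0 (i : ℤ)]; congr 1; omega
      have hthird : modRep n (v + (1 + 3 * j : ℕ)) = modRep n (i + 2 + 3 * j) := by
        rw [hc]; congr 1; push_cast; ring
      rcases Nat.eq_zero_or_pos j with rfl | hj0
      · refine ⟨n - 1, by rw [Finset.mem_Icc]; omega, fun g hg => ?_⟩
        have hpar : par n (n - 1) = 1 + 3 * 0 := by unfold par; split_ifs <;> omega
        rw [hpar, hlast, hthird, Finset.mem_insert, Finset.mem_singleton]
        obtain ⟨hgv, h | h | h⟩ := hG g hg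
        · exact Or.inl h
        · exact absurd (h.trans hvi.symm) hgv
        · exact Or.inr h
      · refine ⟨1 + 3 * j, by rw [Finset.mem_Icc]; omega, fun g hg => ?_⟩
        have hpar : par n (1 + 3 * j) = n - 1 := by unfold par; split_ifs <;> omega
        rw [hpar, hlast, hthird, Finset.mem_insert, Finset.mem_singleton]
        obtain ⟨hgv, h | h | h⟩ := hG g hg
        · exact Or.inr h
        · exact absurd (h.trans hvi.symm) hgv
        · exact Or.inl h
    · have hc := modRep_congr hn0 (hv0.trans hvi)
      refine ⟨3 * (p - 1 - j), by rw [Finset.mem_Icc]; omega, fun g hg => ?_⟩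
      have hpar : par n (3 * (p - 1 - j)) = 3 * (p - 1 - j) + 1 := by
        unfold par; split_ifs <;> omega
      have e1 : modRep n (v + (3 * (p - 1 - j) : ℕ)) = modRep n i := by
        rw [hc, ← modRep_add_self hn0 (i : ℤ)]; congr 1; omega
      have e2 : modRep n (v + (3 * (p - 1 - j) + 1 : ℕ)) = modRep n (i + 1) := by
        rw [hc, ← modRep_add_self hn0 ((i : ℤ) + 1)]; congr 1; omega
      rw [hpar, e1, e2, Finset.mem_insert, Finset.mem_singleton]
      obtain ⟨hgv, h | h | h⟩ := hG g hg
      · exact Or.inl h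
      · exact Or.inr h
      · exact absurd (h.trans hvi.symm) hgv
  · rintro ⟨x, hx, hG⟩
    have hparmem := par_mem hn hx
    have hx1 : x ∈ Finset.Icc 1 (n - 1) := Finset.Icc_subset_Icc_left (by omega) hx
    refine ⟨fun h => ?_, ?_⟩
    · have := hG h
      rw [Finset.mem_insert, Finset.mem_singleton] at this
      rcases this with h | h
      · exact offset_ne hv hx1 h.symm
      · exact offset_ne hv hparmem h.symm
    rw [Finset.mem_Icc] at hx
    have key : ∀ (i : ℤ) (j : ℕ), j < p - 1 → v ∈ tri n i j → modRep n (v + x) ∈ tri n i j →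
        modRep n (v + par n x) ∈ tri n i j → G ∪ {v} ∈ hatDeltaA p := by
      intro i j hj h1 h2 h3
      refine mem_hatDeltaA_of_subset_tri hp hn hj (Finset.union_subset (hG.trans ?_) (by simpa))
      intro g hg
      rw [Finset.mem_insert, Finset.mem_singleton] at hg
      rcases hg with rfl | rfl <;> assumption
    rcases (by omega : x % 3 = 2 ∨ x % 3 = 0 ∨ x % 3 = 1) with h | h | h
    · have hpar : par n x = 1 := by unfold par; split_ifs; omega
      obtain ⟨j, rfl⟩ : ∃ j, x = 3 * j + 2 := ⟨x / 3, by omega⟩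
      have e : (v : ℤ) + 2 + 3 * j = v + (3 * j + 2) := by ring
      apply key v j (by omega) <;> simp [tri, hv0, hpar, e]
    · have hpar : par n x = x + 1 := by unfold par; split_ifs <;> omega
      have e : (v : ℤ) + x - n + 2 + 3 * (p - 1 - x / 3 : ℕ) = v := by omega
      have e0 : modRep n ((v : ℤ) + x - n) = modRep n (v + x) := by
        rw [← modRep_add_self hn0, sub_add_cancel]
      have e1 : modRep n ((v : ℤ) + x - n + 1) = modRep n (v + (x + 1)) := by
        rw [← modRep_add_self hn0]; congr 1; ring
      apply key (v + x - n) (p - 1 - x / 3) (by omega) <;> simp [tri, hv0, hpar, e, e0, e1]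
    · have e0 : modRep n ((v : ℤ) - 1) = modRep n (v + (n - 1 : ℕ)) := by
        rw [← modRep_add_self hn0]; congr 1; omega
      by_cases hxn : x + 1 = n
      · have hpar : par n x = 1 := by unfold par; split_ifs <;> omega
        obtain rfl : x = n - 1 := by omega
        have e : (v : ℤ) - 1 + 2 = v + 1 := by ring
        apply key (v - 1) 0 (by omega) <;> simp [tri, hv0, hpar, e, e0]
      · have hpar : par n x = n - 1 := by unfold par; split_ifs <;> omega
        obtain ⟨j, rfl⟩ : ∃ j, x = 3 * j + 1 := ⟨x / 3, by omega⟩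
        have e : (v : ℤ) - 1 + 2 + 3 * j = v + (3 * j + 1) := by ring
        apply key (v - 1) j (by omega) <;> simp [tri, hv0, hpar, e, e0]

lemma exists_edge_mem_link (hp : 2 ≤ p) (hn : n + 1 = 3 * p) {v x : ℕ}
    (hv : v ∈ Finset.Icc 1 n) (hx : x ∈ Finset.Icc 1 (n - 1)) :
    ∃ w, w ≠ modRep n (v + x) ∧ {w, modRep n (v + x)} ∈ link (hatDeltaA p) {v} := by
  have hn0 : 0 < n := by omega
  have h2 : 2 ∈ Finset.Icc 2 (n - 1) := by rw [Finset.mem_Icc]; omega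
  have main : ∀ y ∈ Finset.Icc 2 (n - 1), modRep n (v + par n y) ≠ modRep n (v + y) ∧
      {modRep n (v + par n y), modRep n (v + y)} ∈ link (hatDeltaA p) {v} := by
    intro y hy
    refine ⟨fun h => par_ne hn hy (offset_injOn hn0 v (par_mem hn hy) ?_ h), ?_⟩
    · exact Finset.Icc_subset_Icc_left (by omega) hy
    · exact (mem_link_hatDeltaA hp hn hv _).2 ⟨y, hy, by rw [Finset.pair_comm]⟩
  by_cases hx1 : x = 1
  · subst hx1
    have := main 2 h2
    have hpar : par n 2 = 1 := by simp [par]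
    rw [hpar] at this
    exact ⟨_, this.1.symm, by rw [Finset.pair_comm]; exact this.2⟩
  · refine ⟨_, main x ?_⟩
    rw [Finset.mem_Icc] at *
    omega

lemma link_hatDeltaA_downward (hp : 2 ≤ p) (hn : n + 1 = 3 * p) {v : ℕ}
    (hv : v ∈ Finset.Icc 1 n) :
    ∀ F ∈ link (hatDeltaA p) {v}, ∀ G ⊆ F, G ∈ link (hatDeltaA p) {v} := by
  intro F hF G hG
  rw [mem_link_hatDeltaA hp hn hv] at hF ⊢
  obtain ⟨x, hx, h⟩ := hF
  exact ⟨x, hx, hG.trans h⟩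

lemma singleton_offset_mem_link (hp : 2 ≤ p) (hn : n + 1 = 3 * p) {v x : ℕ}
    (hv : v ∈ Finset.Icc 1 n) (hx : x ∈ Finset.Icc 1 (n - 1)) :
    {modRep n (v + x)} ∈ link (hatDeltaA p) {v} := by
  obtain ⟨w, -, h⟩ := exists_edge_mem_link hp hn hv hx
  exact link_hatDeltaA_downward hp hn hv _ h _ (by simp)

lemma exists_offset_of_singleton_mem_link (hp : 2 ≤ p) (hn : n + 1 = 3 * p) {v u : ℕ}
    (hv : v ∈ Finset.Icc 1 n) (hu : {u} ∈ link (hatDeltaA p) {v}) :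
    ∃ x ∈ Finset.Icc 1 (n - 1), modRep n (v + x) = u := by
  obtain ⟨x, hx, h⟩ := (mem_link_hatDeltaA hp hn hv _).1 hu
  rw [Finset.singleton_subset_iff, Finset.mem_insert, Finset.mem_singleton] at h
  rcases h with rfl | rfl
  · exact ⟨x, Finset.Icc_subset_Icc_left (by omega) hx, rfl⟩
  · exact ⟨_, par_mem hn hx, rfl⟩

lemma card_le_two_of_mem_link (hp : 2 ≤ p) (hn : n + 1 = 3 * p) {v : ℕ}
    (hv : v ∈ Finset.Icc 1 n) : ∀ F ∈ link (hatDeltaA p) {v}, F.card ≤ 2 := by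
  intro F hF
  obtain ⟨x, -, h⟩ := (mem_link_hatDeltaA hp hn hv _).1 hF
  exact (Finset.card_le_card h).trans Finset.card_le_two

lemma facesOf_link_card_lt (hp : 2 ≤ p) (hn : n + 1 = 3 * p) {v : ℕ} (hv : v ∈ Finset.Icc 1 n) :
    (facesOf (link (hatDeltaA p) {v}) 2).card < (facesOf (link (hatDeltaA p) {v}) 1).card := by
  have h2 : facesOf (link (hatDeltaA p) {v}) 2 ⊆ (Finset.Icc 2 (n - 1)).image fun x : ℕ =>
      ({modRep n (v + x), modRep n (v + par n x)} : Finset ℕ) := by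
    intro F hF
    obtain ⟨hF, hF2⟩ := Finset.mem_filter.1 hF
    obtain ⟨x, hx, h⟩ := (mem_link_hatDeltaA hp hn hv _).1 hF
    exact Finset.mem_image.2
      ⟨x, hx, (Finset.eq_of_subset_of_card_le h (hF2 ▸ Finset.card_le_two)).symm⟩
  have h1 : ((Finset.Icc 1 (n - 1)).image fun x : ℕ => ({modRep n (v + x)} : Finset ℕ)) ⊆
      facesOf (link (hatDeltaA p) {v}) 1 := by
    intro F hF
    obtain ⟨x, hx, rfl⟩ := Finset.mem_image.1 hF
    exact Finset.mem_filter.2 ⟨singleton_offset_mem_link hp hn hv hx, Finset.card_singleton _⟩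
  have c2 := (Finset.card_le_card h2).trans Finset.card_image_le
  have c1 := Finset.card_le_card h1
  rw [Finset.card_image_of_injOn] at c1
  · rw [Nat.card_Icc] at c1 c2
    omega
  · intro x hx y hy h
    exact offset_injOn (by omega) v hx hy (Finset.singleton_injective h)

lemma homDim_link_hatDeltaA (K : Type) [Field K] (hp : 2 ≤ p) (hn : n + 1 = 3 * p) {v : ℕ}
    (hv : v ∈ Finset.Icc 1 n) (m : ℕ) : homDim K (link (hatDeltaA p) {v}) m = 0 := by
  have hr := singleton_offset_mem_link hp hn hv (x := 1) (by rw [Finset.mem_Icc]; omega)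
  refine homDim_eq_zero_of_tree hr (card_le_two_of_mem_link hp hn hv) (fun u hu => ?_)
    (facesOf_link_card_lt hp hn hv) m
  obtain ⟨x, hx, rfl⟩ := exists_offset_of_singleton_mem_link hp hn hv hu
  clear hu
  revert x
  refine par_induction hp hn (by simp) fun x hx ih => ?_
  have hx1 : x ∈ Finset.Icc 1 (n - 1) := Finset.Icc_subset_Icc_left (by omega) hx
  rw [← sub_add_sub_cancel _ (Finsupp.single {modRep n (v + par n x)} (1 : K))]
  refine add_mem (vertex_sub_vertex_mem_boundaries (fun h => ?_) ?_) ih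
  · exact par_ne hn hx (offset_injOn (by omega) v (par_mem hn hx) hx1 h)
  · exact (mem_link_hatDeltaA hp hn hv _).2 ⟨x, hx, by rw [Finset.pair_comm]⟩

lemma singleton_mem_hatDeltaA (hp : 2 ≤ p) (hn : n + 1 = 3 * p) (v : ℕ) :
    {v} ∈ hatDeltaA p ↔ v ∈ Finset.Icc 1 n := by
  constructor
  · exact fun h => subset_Icc_of_mem_hatDeltaA hp hn h (by simp)
  · intro hv
    refine mem_hatDeltaA_of_subset_tri (i := v) (j := 0) hp hn (by omega) ?_
    simp [tri, modRep_of_mem hv]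

lemma facesOf_one_hatDeltaA (hp : 2 ≤ p) (hn : n + 1 = 3 * p) :
    facesOf (hatDeltaA p) 1 = Finset.powersetCard 1 (Finset.Icc 1 n) := by
  ext F
  rw [facesOf, Finset.mem_filter, Finset.mem_powersetCard]
  refine and_congr_left fun hF => ?_
  obtain ⟨v, rfl⟩ := Finset.card_eq_one.1 hF
  rw [singleton_mem_hatDeltaA hp hn, Finset.singleton_subset_iff]

lemma facesOf_two_hatDeltaA (hp : 2 ≤ p) (hn : n + 1 = 3 * p) :
    facesOf (hatDeltaA p) 2 = Finset.powersetCard 2 (Finset.Icc 1 n) := by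
  ext F
  rw [facesOf, Finset.mem_filter, Finset.mem_powersetCard]
  refine and_congr_left fun hF => ⟨subset_Icc_of_mem_hatDeltaA hp hn, fun h => ?_⟩
  obtain ⟨a, b, hab, rfl⟩ := Finset.card_eq_two.1 hF
  rw [Finset.insert_subset_iff, Finset.singleton_subset_iff] at h
  obtain ⟨x, hx, rfl⟩ := exists_offset h.2 h.1 hab
  have := ((mem_link (hatDeltaA_downward hp hn)).1
    (singleton_offset_mem_link hp hn h.2 hx)).2
  rwa [← Finset.insert_eq] at this

lemma card_facesOf_three_hatDeltaA (hp : 2 ≤ p) (hn : n + 1 = 3 * p) :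
    (facesOf (hatDeltaA p) 3).card = n * (p - 1) := by
  have : facesOf (hatDeltaA p) 3 =
      (Finset.Icc 1 n ×ˢ Finset.range (p - 1)).image fun q => tri n (q.1 : ℕ) q.2 := by
    ext F
    simp only [facesOf, Finset.mem_filter, Finset.mem_image, Finset.mem_product,
      Finset.mem_range, Prod.exists]
    constructor
    · rintro ⟨hF, hF3⟩
      obtain ⟨i, hi, j, hj, h⟩ := (mem_hatDeltaA hp hn F).1 hF
      exact ⟨i, j, ⟨hi, hj⟩,
        (Finset.eq_of_subset_of_card_le h (hF3 ▸ (card_tri hn _ hj).le)).symm⟩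
    · rintro ⟨i, j, ⟨hi, hj⟩, rfl⟩
      exact ⟨mem_hatDeltaA_of_subset_tri hp hn hj subset_rfl, card_tri hn _ hj⟩
  rw [this, Finset.card_image_of_injOn]
  · simp
  · rintro ⟨i, j⟩ hq ⟨i', j'⟩ hq' h
    simp only [Finset.coe_product, Set.mem_prod, Finset.mem_coe, Finset.mem_range] at hq hq'
    obtain ⟨rfl, rfl⟩ := tri_injOn hn hq.1 hq'.1 hq.2 hq'.2 h
    rfl

lemma isPure_hatDeltaA (hp : 2 ≤ p) (hn : n + 1 = 3 * p) : IsPure (hatDeltaA p) := by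
  have tri_mem : ∀ i : ℤ, ∀ j < p - 1, tri n i j ∈ hatDeltaA p := fun i j hj =>
    mem_hatDeltaA_of_subset_tri hp hn hj subset_rfl
  have hsup : (hatDeltaA p).sup Finset.card = 3 := by
    refine le_antisymm (Finset.sup_le fun F hF => card_le_three_of_mem_hatDeltaA hp hn hF) ?_
    rw [← card_tri hn 1 (j := 0) (by omega)]
    exact Finset.le_sup (f := Finset.card) (tri_mem 1 0 (by omega))
  intro F hF hmax
  obtain ⟨i, -, j, hj, h⟩ := (mem_hatDeltaA hp hn F).1 hF
  rw [hmax _ (tri_mem i j hj) h, hsup, card_tri hn _ hj]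

lemma isBuchsbaum_hatDeltaA (K : Type) [Field K] (hp : 2 ≤ p) (hn : n + 1 = 3 * p) :
    IsBuchsbaum K (hatDeltaA p) := by
  refine ⟨isPure_hatDeltaA hp hn, fun v hv => ?_⟩
  rw [singleton_mem_hatDeltaA hp hn] at hv
  refine isCohenMacaulay_of_acyclic_graph (link_hatDeltaA_downward hp hn hv)
    (card_le_two_of_mem_link hp hn hv)
    (singleton_offset_mem_link hp hn hv (x := 1) (by rw [Finset.mem_Icc]; omega))
    (fun u hu => ?_) (homDim_link_hatDeltaA K hp hn hv)
  obtain ⟨x, hx, rfl⟩ := exists_offset_of_singleton_mem_link hp hn hv hu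
  exact exists_edge_mem_link hp hn hv hx

lemma isLinkAcyclic_hatDeltaA (K : Type) [Field K] (hp : 2 ≤ p) (hn : n + 1 = 3 * p) :
    IsLinkAcyclic K (hatDeltaA p) := by
  intro v hv i
  rw [singleton_mem_hatDeltaA hp hn] at hv
  exact betti_eq_zero_of_homDim fun _ => homDim_link_hatDeltaA K hp hn hv _

end Facets

lemma hVector3_hatDeltaA {p : ℕ} (hp : 2 ≤ p) :
    hVector3 (hatDeltaA p) 1 (((3 * p - 1 : ℕ) : ℤ) - 3)
      (3 * (((3 * p - 1 - 2).choose 2 / 3 : ℕ) : ℤ))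
      (-(((3 * p - 1 - 2).choose 2 / 3 : ℕ) : ℤ)) := by
  have hn : 3 * p - 1 + 1 = 3 * p := by omega
  have f0 : fVec (hatDeltaA p) 0 = 1 := rfl
  have f1 : fVec (hatDeltaA p) 1 = (3 * p - 1 : ℕ) := by
    simp [fVec, facesOf_one_hatDeltaA hp hn]
  have f2 : fVec (hatDeltaA p) 2 = ((3 * p - 1).choose 2 : ℕ) := by
    simp [fVec, facesOf_two_hatDeltaA hp hn]
  have f3 : fVec (hatDeltaA p) 3 = ((3 * p - 1) * (p - 1) : ℕ) := by
    simp [fVec, card_facesOf_three_hatDeltaA hp hn]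
  obtain ⟨q, rfl⟩ : ∃ q, p = q + 2 := ⟨p - 2, by omega⟩
  have c1 : 3 * (q + 2) - 1 = 3 * q + 5 := by omega
  have c2 : 3 * q + 5 - 2 = 3 * q + 3 := by omega
  have c3 : q + 2 - 1 = q + 1 := by omega
  rw [c1] at f1 f2
  rw [c1, c3] at f3
  rw [c1, c2]
  obtain ⟨t, ht⟩ : ∃ t, (q + 1) * (3 * q + 2) = 2 * t := by
    rcases Nat.even_or_odd' q with ⟨k, rfl | rfl⟩
    · exact ⟨(2 * k + 1) * (3 * k + 1), by ring⟩
    · exact ⟨(k + 1) * (6 * k + 5), by ring⟩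
  have d1 : (3 * q + 5).choose 2 = 3 * t + 6 * q + 7 := by
    rw [Nat.choose_two_right, show 3 * q + 5 - 1 = 3 * q + 4 by omega]
    exact Nat.div_eq_of_eq_mul_right two_pos (by nlinarith)
  have d2 : (3 * q + 3).choose 2 = 3 * t := by
    rw [Nat.choose_two_right, show 3 * q + 3 - 1 = 3 * q + 2 by omega]
    exact Nat.div_eq_of_eq_mul_right two_pos (by nlinarith)
  have d3 : (3 * q + 5) * (q + 1) = 2 * t + 3 * (q + 1) := by nlinarith
  have d4 : 3 * t / 3 = t := by omega
  rw [d1] at f2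
  rw [d3] at f3
  rw [d2, d4]
  refine ⟨?_, ?_, ?_, ?_⟩ <;>
    simp [hVec, Finset.sum_range_succ, f0, f1, f2, f3] <;> ring

/-- **Lemma 3.2(i)** (Hanano). For `n = 3p-1`, `Δ̂` is Buchsbaum, link-acyclic and
`h(Δ̂) = (1, n-3, 3M, -M)` where `M = C(n-2,2)/3`. -/
theorem stmt12 (K : Type) [Field K] (p : ℕ) (hp : 2 ≤ p) :
    IsBuchsbaum K (hatDeltaA p) ∧ IsLinkAcyclic K (hatDeltaA p) ∧
      hVector3 (hatDeltaA p) 1 (((3 * p - 1 : ℕ) : ℤ) - 3)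
        (3 * (((3 * p - 1 - 2).choose 2 / 3 : ℕ) : ℤ)) (-(((3 * p - 1 - 2).choose 2 / 3 : ℕ) : ℤ)) := by
  have hn : 3 * p - 1 + 1 = 3 * p := by omega
  exact ⟨isBuchsbaum_hatDeltaA K hp hn, isLinkAcyclic_hatDeltaA K hp hn, hVector3_hatDeltaA hp⟩
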